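/- arXiv:2111.11568 — 2 statements merged into one kernel-verified Lean document; each statement's English description precedes it below -/
import Mathlib

section
/- If a finite nilpotent group G is unramified over a nontrivial abelian normal subgroup N, then G′ is a proper subgroup of N; in particular, every totally unramified finite nilpotent group is metabelian. -/
open scoped BigOperators

noncomputable def charInner (G : Type) [Group G] (φ ψ : G → ℂ) : ℂ :=
  (Nat.card G : ℂ)⁻¹ * ∑ᶠ g, φ g * (starRingEnd ℂ) (ψ g)

/-- `χ` is the character of some irreducible complex representation of `G`. -/
def IsIrrChar (G : Type) [Group G] (χ : G → ℂ) : Prop :=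
  ∃ ρ : FDRep ℂ G, CategoryTheory.Simple ρ ∧ FDRep.character ρ = χ

/-- A class function is multiplicity free if it pairs with each irreducible
character with multiplicity at most one. -/
def MultFree (G : Type) [Group G] (φ : G → ℂ) : Prop :=
  ∀ μ : G → ℂ, IsIrrChar G μ → charInner G φ μ = 0 ∨ charInner G φ μ = 1

/-- `G` is unramified over `N`: every irreducible character of `G` restricts to `N`
multiplicity-freely or as a multiple of the trivial character. -/
def UnramifiedOver (G : Type) [Group G] (N : Subgroup G) : Prop :=
  ∀ χ : G → ℂ, IsIrrChar G χ →
    MultFree N (fun n : N => χ n) ∨ ∀ n : N, χ n = χ 1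

def PseudoUnramifiedOver (G : Type) [Group G] (N : Subgroup G) : Prop :=
  ∀ μ : ↥N → ℂ, IsIrrChar ↥N μ →
    ∃ χ : G → ℂ, IsIrrChar G χ ∧ charInner ↥N (fun n : N => χ n) μ ≠ 0 ∧
      MultFree ↥N (fun n : N => χ n)

/-- The conjugate character `ᵍμ(n) = μ(g⁻¹ n g)`. -/
def conjChar {G : Type} [Group G] (N : Subgroup G) [hN : N.Normal] (g : G)
    (μ : ↥N → ℂ) : ↥N → ℂ :=
  fun n => μ ⟨g⁻¹ * ↑n * g, hN.conj_mem' ↑n n.2 g⟩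

lemma conjChar_mul {G : Type} [Group G] (N : Subgroup G) [N.Normal] (a b : G)
    (μ : ↥N → ℂ) : conjChar N (a * b) μ = conjChar N a (conjChar N b μ) := by
  funext n
  simp [conjChar, mul_assoc]

lemma conjChar_one {G : Type} [Group G] (N : Subgroup G) [N.Normal]
    (μ : ↥N → ℂ) : conjChar N 1 μ = μ := by
  funext n
  simp [conjChar]

/-- The inertia subgroup of μ. -/
def inertia {G : Type} [Group G] (N : Subgroup G) [N.Normal] (μ : ↥N → ℂ) :
    Subgroup G where
  carrier := {g | conjChar N g μ = μ}
  one_mem' := conjChar_one N μ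
  mul_mem' := by
    intro a b ha hb
    simp only [Set.mem_setOf_eq] at *
    rw [conjChar_mul, hb, ha]
  inv_mem' := by
    intro a ha
    simp only [Set.mem_setOf_eq] at *
    conv_lhs => rw [← ha]
    rw [← conjChar_mul, inv_mul_cancel, conjChar_one]

/-- G is totally unramified: there is a chain of normal subgroups
⊥ = N₀ < N₁ < ⋯ < Nₙ = G such that each quotient N_{j+1}/N_j is abelian and
G/N_j is unramified over N_{j+1}/N_j. -/
def TotallyUnramified (G : Type) [Group G] : Prop :=
  ∃ (n : ℕ) (N : Fin (n + 1) → Subgroup G),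
    (∀ i, (N i).Normal) ∧ N 0 = ⊥ ∧ N (Fin.last n) = ⊤ ∧
    ∀ (i : Fin n) (h : (N i.castSucc).Normal),
      N i.castSucc < N i.succ ∧
      (letI := h;
        (∀ a b : ↥((N i.succ).map (QuotientGroup.mk' (N i.castSucc))),
            a * b = b * a) ∧
        UnramifiedOver (G ⧸ N i.castSucc)
          ((N i.succ).map (QuotientGroup.mk' (N i.castSucc))))

open scoped MonoidAlgebra

/-- The character of an irreducible finite-dimensional representation satisfies `IsIrrChar`. -/
lemma isIrrChar_character {G : Type} [Group G] [Finite G] {V : Type} [AddCommGroup V]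
    [Module ℂ V] [FiniteDimensional ℂ V] (ρ : Representation ℂ G V) [ρ.IsIrreducible] :
    IsIrrChar G ρ.character := by
  have := Fintype.ofFinite G
  refine ⟨FDRep.of ρ, ?_, rfl⟩
  rw [FDRep.simple_iff_char_is_norm_one]
  have hG : (Nat.card G : ℂ) ≠ 0 := NeZero.ne _
  have := invertibleOfNonzero hG
  have h := Representation.char_orthonormal ρ ρ
  rw [if_pos ⟨Representation.Equiv.refl ρ⟩] at h
  exact (inv_mul_eq_one₀ hG).1 h |>.symm

/-- A homomorphism to `ℂˣ` is an irreducible character. -/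
lemma isIrrChar_units {H : Type} [Group H] [Finite H] (μ : H →* ℂˣ) :
    IsIrrChar H (fun h => (μ h : ℂ)) := by
  have := Fintype.ofFinite H
  let ρ : Representation ℂ H ℂ :=
    (Algebra.lmul ℂ ℂ).toMonoidHom.comp ((Units.coeHom ℂ).comp μ)
  have hρ : (FDRep.of ρ).character = fun h => (μ h : ℂ) := by
    funext h
    exact Algebra.trace_self_apply (R := ℂ) (μ h : ℂ)
  refine ⟨FDRep.of ρ, ?_, hρ⟩
  rw [FDRep.simple_iff_char_is_norm_one, hρ]
  simp

lemma conj_apply_units {H : Type} [Group H] [Finite H] (μ : H →* ℂˣ) (h : H) :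
    (starRingEnd ℂ) (μ h : ℂ) = ((μ h)⁻¹ : ℂˣ) := by
  rw [Units.val_inv_eq_inv_val, Complex.inv_eq_conj]
  apply Complex.norm_eq_one_of_pow_eq_one (n := Nat.card H) _ Nat.card_pos.ne'
  rw [← Units.val_pow_eq_pow_val, ← map_pow, pow_card_eq_one', map_one, Units.val_one]

lemma charInner_const_mul_units {H : Type} [Group H] [Finite H] (μ : H →* ℂˣ) (c : ℂ) :
    charInner H (fun h => (μ h : ℂ) * c) (fun h => (μ h : ℂ)) = c := by
  have := Fintype.ofFinite H
  have h : ∀ h : H, (μ h : ℂ) * c * (starRingEnd ℂ) (μ h : ℂ) = c := fun h => by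
    rw [conj_apply_units, mul_right_comm, Units.mul_inv, one_mul]
  have hH : (Nat.card H : ℂ) ≠ 0 := NeZero.ne _
  simp [charInner, h, finsum_eq_sum_of_fintype, ← Nat.card_eq_fintype_card, hH]

/-- If `G` is unramified over `N`, an irreducible representation on which `N` acts through a
nontrivial linear character is one-dimensional. -/
lemma finrank_eq_one_of_unramifiedOver {G : Type} [Group G] [Finite G] {N : Subgroup G}
    (hN : UnramifiedOver G N) {μ : N →* ℂˣ} (hμ : μ ≠ 1) {V : Type} [AddCommGroup V]
    [Module ℂ V] [FiniteDimensional ℂ V] (ρ : Representation ℂ G V) [ρ.IsIrreducible]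
    [Nontrivial V] (hρ : ∀ n : N, ρ n = (μ n : ℂ) • LinearMap.id) :
    Module.finrank ℂ V = 1 := by
  have hd : (Module.finrank ℂ V : ℂ) ≠ 0 := Nat.cast_ne_zero.2 Module.finrank_pos.ne'
  have hχ : ∀ n : N, ρ.character n = (μ n : ℂ) * Module.finrank ℂ V := fun n => by
    simp [Representation.character, hρ n, LinearMap.trace_id]
  rcases hN _ (isIrrChar_character ρ) with h | h
  · have := h _ (isIrrChar_units μ)
    simp_rw [hχ, charInner_const_mul_units] at this
    exact_mod_cast this.resolve_left hd
  · refine absurd (MonoidHom.ext fun n => Units.ext ?_) hμ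
    have := h n
    rw [hχ, Representation.char_one] at this
    simpa [hd] using this

lemma apply_eq_one_of_mem_commutator {G V : Type} [Group G] [AddCommGroup V] [Module ℂ V]
    (ρ : Representation ℂ G V) (hV : Module.finrank ℂ V = 1) {g : G} (hg : g ∈ commutator G) :
    ρ g = 1 := by
  have hcomm : ∀ a b : Module.End ℂ V, a * b = b * a := fun a b => by
    obtain ⟨x, rfl, -⟩ := LinearMap.existsUnique_eq_smul_id_of_finrank_eq_one hV a
    ext v
    simp
  suffices commutator G ≤ MonoidHom.ker ρ from this hg
  rw [commutator_def, Subgroup.commutator_le]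
  intro a _ b _
  rw [MonoidHom.mem_ker, commutatorElement_def, map_mul, map_mul, map_mul, hcomm (ρ a),
    mul_assoc (ρ b), ← map_mul, mul_inv_cancel, map_one, mul_one, ← map_mul, mul_inv_cancel,
    map_one]

/-- The left ideal of `ℂ[G]` on which `N` acts through the `G`-invariant linear character `μ`. -/
def isotypicIdeal {G : Type} [Group G] (N : Subgroup G) [hN : N.Normal] (μ : N →* ℂˣ)
    (hμ : ∀ (g : G) (n : N), μ ⟨g⁻¹ * n * g, hN.conj_mem' n n.2 g⟩ = μ n) :
    Submodule ℂ[G] ℂ[G] where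
  carrier := {x | ∀ n : N, MonoidAlgebra.single (n : G) (1 : ℂ) * x = (μ n : ℂ) • x}
  zero_mem' n := by simp
  add_mem' hx hy n := by rw [mul_add, hx n, hy n, smul_add]
  smul_mem' a x hx := by
    induction a using MonoidAlgebra.induction_on with
    | of g =>
      intro n
      have h : (n : G) * g = g * (g⁻¹ * n * g) := by group
      have hx' := hx ⟨g⁻¹ * n * g, hN.conj_mem' n n.2 g⟩
      rw [hμ] at hx'
      rw [smul_eq_mul, MonoidAlgebra.of_apply, ← mul_assoc, MonoidAlgebra.single_mul_single, h,
        ← MonoidAlgebra.single_mul_single, mul_assoc, hx', mul_smul_comm]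
    | add a b ha hb =>
      intro n
      rw [add_smul, mul_add, ha n, hb n, smul_add]
    | smul r a ha =>
      intro n
      rw [smul_assoc, mul_smul_comm, ha n, smul_comm]

lemma isIrreducible_ofModule' {k G M : Type*} [Field k] [Monoid G] [AddCommGroup M] [Module k M]
    [Module k[G] M] [IsScalarTower k k[G] M] [IsSimpleModule k[G] M] :
    (Representation.ofModule' (k := k) (G := G) M).IsIrreducible := by
  rw [Representation.irreducible_iff_isSimpleModule_asModule]
  let ρ := Representation.ofModule' (k := k) (G := G) M
  have h : ρ.asAlgebraHom = Algebra.lsmul k k M := Equiv.apply_symm_apply _ _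
  let e : ρ.asModule ≃ₗ[k[G]] M :=
    { ρ.asModuleEquiv with
      map_smul' := fun a v => (ρ.asModuleEquiv_map_smul a v).trans (by rw [h]; rfl) }
  exact IsSimpleModule.congr e

lemma single_mul_eq_self_of_mem_isotypicIdeal {G : Type} [Group G] [Finite G] {N : Subgroup G}
    [hN : N.Normal] (hG : UnramifiedOver G N) {μ : N →* ℂˣ} (hμ1 : μ ≠ 1)
    (hμ : ∀ (g : G) (n : N), μ ⟨g⁻¹ * n * g, hN.conj_mem' n n.2 g⟩ = μ n)
    {g : G} (hg : g ∈ commutator G) {x : ℂ[G]} (hx : x ∈ isotypicIdeal N μ hμ) :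
    MonoidAlgebra.single g (1 : ℂ) * x = x := by
  rw [← IsSemisimpleModule.sSup_simples_le (isotypicIdeal N μ hμ), sSup_eq_iSup'] at hx
  refine Submodule.iSup_induction _
    (motive := fun y => MonoidAlgebra.single g (1 : ℂ) * y = y) hx ?_ (mul_zero _)
    fun a b ha hb => by rw [mul_add, ha, hb]
  rintro ⟨S, hS, hSle⟩ s hs
  change s ∈ S at hs
  let ρ : Representation ℂ G S := Representation.ofModule' S
  have hirr : ρ.IsIrreducible := isIrreducible_ofModule'
  have hnt : Nontrivial S := IsSimpleModule.nontrivial ℂ[G] S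
  have hfin : FiniteDimensional ℂ S := Module.Finite.trans ℂ[G] S
  have hact : ∀ (h : G) (v : S),
      (ρ h v : ℂ[G]) = MonoidAlgebra.single h (1 : ℂ) * (v : ℂ[G]) :=
    fun h v => rfl
  have hρ : ∀ n : N, ρ n = (μ n : ℂ) • LinearMap.id :=
    fun n => LinearMap.ext fun v => Subtype.ext ((hact n v).trans (hSle v.2 n))
  have h1 := apply_eq_one_of_mem_commutator ρ (finrank_eq_one_of_unramifiedOver hG hμ1 ρ hρ) hg
  have h2 := hact g ⟨s, hs⟩
  rw [h1] at h2
  exact h2.symm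

/-- If `G` is unramified over `N`, then `G'` lies in the kernel of every nontrivial `G`-invariant
linear character of `N`. -/
lemma commutator_le_map_ker {G : Type} [Group G] [Finite G] {N : Subgroup G}
    [hN : N.Normal] (hG : UnramifiedOver G N) {μ : N →* ℂˣ} (hμ1 : μ ≠ 1)
    (hμ : ∀ (g : G) (n : N), μ ⟨g⁻¹ * n * g, hN.conj_mem' n n.2 g⟩ = μ n) :
    commutator G ≤ μ.ker.map N.subtype := by
  classical
  intro g hg
  let e : ℂ[G] := MonoidAlgebra.ofCoeff (Finsupp.equivFunOnFinite.symm fun x : G =>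
    if h : x ∈ N then ((μ ⟨x, h⟩)⁻¹ : ℂˣ) else (0 : ℂ))
  have he : ∀ x, e.coeff x = if h : x ∈ N then (((μ ⟨x, h⟩)⁻¹ : ℂˣ) : ℂ) else (0 : ℂ) :=
    fun x => rfl
  have hmem : e ∈ isotypicIdeal N μ hμ := by
    intro n
    ext x
    rw [MonoidAlgebra.coeff_single_mul_apply, one_mul, MonoidAlgebra.coeff_smul,
      Finsupp.smul_apply, he, he]
    by_cases hx : x ∈ N
    · have hx' : (n : G)⁻¹ * x ∈ N := N.mul_mem (N.inv_mem n.2) hx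
      have : (⟨(n : G)⁻¹ * x, hx'⟩ : N) = n⁻¹ * ⟨x, hx⟩ := rfl
      rw [dif_pos hx, dif_pos hx', this]
      simp [mul_comm]
    · have hx' : (n : G)⁻¹ * x ∉ N := fun h =>
        hx (by simpa using N.mul_mem n.2 h)
      rw [dif_neg hx, dif_neg hx', smul_zero]
  have h := congrArg (fun y : ℂ[G] => y.coeff g)
    (single_mul_eq_self_of_mem_isotypicIdeal hG hμ1 hμ hg hmem)
  simp only [MonoidAlgebra.coeff_single_mul_apply, one_mul, inv_mul_cancel] at h
  rw [he, he, dif_pos N.one_mem] at h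
  have h1 : (⟨1, N.one_mem⟩ : N) = 1 := rfl
  rw [h1, map_one, inv_one, Units.val_one] at h
  by_cases hgN : g ∈ N
  · rw [dif_pos hgN] at h
    refine ⟨⟨g, hgN⟩, ?_, rfl⟩
    have : (μ ⟨g, hgN⟩)⁻¹ = 1 := Units.ext h.symm
    exact inv_eq_one.1 this
  · rw [dif_neg hgN] at h
    exact absurd h one_ne_zero

lemma commutator_top_lt {G : Type*} [Group G] [Group.IsNilpotent G] {N : Subgroup G}
    [N.Normal] (hN : N ≠ ⊥) : ⁅N, (⊤ : Subgroup G)⁆ < N := by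
  refine lt_of_le_of_ne (Subgroup.commutator_le_left N ⊤) fun h => hN ?_
  obtain ⟨k, hk⟩ := Subgroup.nilpotent_iff_lowerCentralSeries.1 ‹Group.IsNilpotent G›
  suffices ∀ k, N ≤ (⊤ : Subgroup G).lowerCentralSeries k from le_bot_iff.1 (hk ▸ this k)
  intro k
  induction k with
  | zero => simp
  | succ k ih =>
    rw [Subgroup.lowerCentralSeries_succ, ← h]
    exact Subgroup.commutator_mono ih le_rfl

/-- A nontrivial abelian normal subgroup of a finite nilpotent group has a nontrivial
`G`-invariant linear character. -/
lemma exists_invariant_units {G : Type*} [Group G] [Finite G] [Group.IsNilpotent G]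
    {N : Subgroup G} [hN : N.Normal] (hab : ∀ a b : N, a * b = b * a) (hbot : N ≠ ⊥) :
    ∃ μ : N →* ℂˣ, μ ≠ 1 ∧
      ∀ (g : G) (n : N), μ ⟨g⁻¹ * n * g, hN.conj_mem' n n.2 g⟩ = μ n := by
  let : CommGroup N := { (inferInstance : Group N) with mul_comm := hab }
  let K : Subgroup N := ⁅N, (⊤ : Subgroup G)⁆.subgroupOf N
  obtain ⟨n, hnN, hnK⟩ := SetLike.exists_of_lt (commutator_top_lt hbot)
  have hn : (QuotientGroup.mk' K ⟨n, hnN⟩) ≠ 1 := fun h =>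
    hnK (Subgroup.mem_subgroupOf.1 ((QuotientGroup.eq_one_iff _).1 h))
  obtain ⟨φ, hφ⟩ := CommGroup.exists_apply_ne_one_of_hasEnoughRootsOfUnity (N ⧸ K) ℂ hn
  refine ⟨φ.comp (QuotientGroup.mk' K), fun h => hφ (DFunLike.congr_fun h _), fun g m => ?_⟩
  refine congrArg φ ((QuotientGroup.eq (s := K)).2 (Subgroup.mem_subgroupOf.2 ?_))
  have := Subgroup.commutator_mem_commutator (Subgroup.mem_top g⁻¹) (N.inv_mem m.2)
  rw [Subgroup.commutator_comm] at this
  simpa [commutatorElement_def, mul_assoc] using this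

lemma commutator_lt_of_unramifiedOver {G : Type} [Group G] [Finite G] [Group.IsNilpotent G]
    {N : Subgroup G} [N.Normal] (hab : ∀ a b : N, a * b = b * a) (hbot : N ≠ ⊥)
    (hG : UnramifiedOver G N) : commutator G < N := by
  obtain ⟨μ, hμ1, hμ⟩ := exists_invariant_units hab hbot
  refine (commutator_le_map_ker hG hμ1 hμ).trans_lt
    (lt_of_le_of_ne (Subgroup.map_subtype_le _) fun h => hμ1 ?_)
  ext n
  obtain ⟨m, hm, hmn⟩ : (n : G) ∈ μ.ker.map N.subtype := by
    rw [h]; exact n.2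
  rw [← Subtype.ext hmn, MonoidHom.mem_ker.1 hm, MonoidHom.one_apply]

/-- For a finite nilpotent group G: if G is unramified over a nontrivial abelian
normal subgroup N then G' ⊊ N; in particular a totally unramified finite
nilpotent group is metabelian. -/
theorem stmt_8 {G : Type} [Group G] [Finite G] [Group.IsNilpotent G] :
    (∀ N : Subgroup G, N.Normal → (∀ a b : ↥N, a * b = b * a) → N ≠ ⊥ →
      UnramifiedOver G N → commutator G < N) ∧
    (TotallyUnramified G →
      ∀ x y : G, x ∈ commutator G → y ∈ commutator G → x * y = y * x) := by
  refine ⟨fun N hN hab hbot hG => commutator_lt_of_unramifiedOver hab hbot hG, ?_⟩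
  rintro ⟨n, N, hN, h0, hlast, hstep⟩ x y hx hy
  rcases n with _ | n
  · have htriv : ∀ g : G, g = 1 := fun g => by
      have : g ∈ N (Fin.last 0) := hlast ▸ Subgroup.mem_top g
      exact Subgroup.mem_bot.1 (h0 ▸ this)
    rw [htriv x, htriv y]
  · have := hN (Fin.castSucc (0 : Fin (n + 1)))
    obtain ⟨hlt, hab, hun⟩ := hstep 0 this
    have h0' : N (Fin.castSucc (0 : Fin (n + 1))) = ⊥ := h0
    set π := QuotientGroup.mk' (N (Fin.castSucc (0 : Fin (n + 1))))
    have hinj : Function.Injective π := by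
      rw [← MonoidHom.ker_eq_bot_iff, QuotientGroup.ker_mk', h0']
    have hnormal : ((N (Fin.succ (0 : Fin (n + 1)))).map π).Normal :=
      (hN _).map π (QuotientGroup.mk'_surjective _)
    have hbot : (N (Fin.succ (0 : Fin (n + 1)))).map π ≠ ⊥ := fun h => by
      rw [Subgroup.map_eq_bot_iff_of_injective _ hinj] at h
      exact hlt.ne (h0'.trans h.symm)
    have hle := (commutator_lt_of_unramifiedOver hab hbot hun).le
    have hmem : ∀ g ∈ commutator G, π g ∈ (N (Fin.succ (0 : Fin (n + 1)))).map π :=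
      fun g hg => hle (by
        have := Subgroup.mem_map_of_mem π hg
        rw [commutator_def, Subgroup.map_commutator] at this
        exact Subgroup.commutator_mono le_top le_top this)
    have := congrArg Subtype.val (hab ⟨π x, hmem x hx⟩ ⟨π y, hmem y hy⟩)
    exact hinj ((map_mul π x y).trans (this.trans (map_mul π y x).symm))
end

section
/- Let G₁ and G₂ be finite groups and suppose Gᵢ is unramified over an abelian normal subgroup Nᵢ with G′ᵢ ⊆ Nᵢ (i = 1,2). Then G₁ × G₂ is unramified over N₁ × N₂. -/
open scoped BigOperators

namespace FDRep

open CategoryTheory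

variable {G : Type} [Group G] [Finite G]

lemma simple_of_isIrreducible {V : Type} [AddCommGroup V] [Module ℂ V] [FiniteDimensional ℂ V]
    (ρ : Representation ℂ G V) [ρ.IsIrreducible] : Simple (of ρ) := by
  have := Fintype.ofFinite G
  have := invertibleOfNonzero (NeZero.ne (Nat.card G : ℂ))
  rw [simple_iff_char_is_norm_one]
  have h := ρ.char_orthonormal ρ
  rw [if_pos ⟨Representation.Equiv.refl ρ⟩, inv_mul_eq_one₀ (NeZero.ne _)] at h
  exact h.symm

/-- Every nonzero complex representation of a finite group receives a nonzero intertwining map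
from a simple one. -/
lemma exists_simple_intertwiningMap_ne_zero {V : Type} [AddCommGroup V] [Module ℂ V]
    [FiniteDimensional ℂ V] [Nontrivial V] (ρ : Representation ℂ G V) :
    ∃ W : FDRep ℂ G, Simple W ∧ ∃ f : Representation.IntertwiningMap W.ρ ρ, f ≠ 0 := by
  have : Nontrivial ρ.asModule := inferInstanceAs (Nontrivial V)
  have : IsAtomic (Subrepresentation ρ) :=
    (OrderIso.isAtomic_iff Subrepresentation.subrepresentationSubmoduleOrderIso).2 inferInstance
  have htop : (⊤ : Subrepresentation ρ) ≠ ⊥ := fun h =>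
    top_ne_bot (α := Submodule ℂ V) (congrArg Subrepresentation.toSubmodule h)
  obtain ⟨s, hs, -⟩ := (IsAtomic.eq_bot_or_exists_atom_le (⊤ : Subrepresentation ρ)).resolve_left
    htop
  have hsub : s.toSubmodule ≠ ⊥ := fun h => hs.1 (Subrepresentation.toSubmodule_injective h)
  have : s.toRepresentation.IsIrreducible :=
    { exists_pair_ne := ⟨⊥, ⊤, fun h => by
        obtain ⟨x, hx, hx0⟩ := Submodule.exists_mem_ne_zero_of_ne_bot hsub
        have h' : (⊥ : Submodule ℂ s.toSubmodule) = ⊤ :=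
          congrArg Subrepresentation.toSubmodule h
        have : (⟨x, hx⟩ : s.toSubmodule) ∈ (⊥ : Submodule ℂ s.toSubmodule) := h' ▸ trivial
        exact hx0 (congrArg Subtype.val ((Submodule.mem_bot ℂ).1 this))⟩
      eq_bot_or_eq_top := fun t => by
        let u : Subrepresentation ρ := ⟨t.toSubmodule.map s.toSubmodule.subtype, by
          rintro g _ ⟨x, hx, rfl⟩
          exact ⟨_, t.apply_mem_toSubmodule g hx, rfl⟩⟩
        have hu : u ≤ s := by
          rintro _ ⟨x, hx, rfl⟩
          exact x.2
        rcases hs.le_iff.1 hu with h | h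
        · left
          apply Subrepresentation.toSubmodule_injective
          apply Submodule.map_injective_of_injective s.toSubmodule.injective_subtype
          exact (congrArg Subrepresentation.toSubmodule h).trans (Submodule.map_bot _).symm
        · right
          apply Subrepresentation.toSubmodule_injective
          apply Submodule.map_injective_of_injective s.toSubmodule.injective_subtype
          have h' : t.toSubmodule.map s.toSubmodule.subtype = s.toSubmodule :=
            congrArg Subrepresentation.toSubmodule h
          rw [h']
          exact (Submodule.map_subtype_top _).symm }
  refine ⟨of s.toRepresentation, simple_of_isIrreducible _,
    ⟨s.toSubmodule.subtype, fun g => rfl⟩, fun h => ?_⟩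
  obtain ⟨x, hx, hx0⟩ := Submodule.exists_mem_ne_zero_of_ne_bot hsub
  exact hx0 (congrArg (fun f => f ⟨x, hx⟩) h)

lemma nontrivial_of_simple (V : FDRep ℂ G) [Simple V] : Nontrivial V := by
  have := Fintype.ofFinite G
  by_contra h
  rw [not_nontrivial_iff_subsingleton] at h
  have h0 : ∀ g, V.character g = 0 := fun g => by
    rw [character, Subsingleton.elim (V.ρ g) 0, map_zero]
  have := (simple_iff_char_is_norm_one V).1 inferInstance
  simp only [h0, mul_zero, Finset.sum_const_zero] at this
  exact NeZero.ne (Nat.card G : ℂ) this.symm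

/-- Simple representations admitting a nonzero intertwining map have the same character. -/
lemma character_eq_of_intertwiningMap_ne_zero {V W : FDRep ℂ G} [Simple V] [Simple W]
    (f : Representation.IntertwiningMap W.ρ V.ρ) (hf : f ≠ 0) : V.character = W.character := by
  have := Fintype.ofFinite G
  have := invertibleOfNonzero (NeZero.ne (Nat.card G : ℂ))
  have h := char_orthonormal V W
  have h' := Representation.card_inv_mul_sum_char_mul_char_eq_finrank W.ρ V.ρ
  by_cases hi : Nonempty (V ≅ W)
  · exact char_iso hi.some
  · rw [if_neg hi] at h
    have h0 := h'.symm.trans h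
    have : Module.Finite ℂ (Representation.IntertwiningMap W.ρ V.ρ) :=
      Module.Finite.equiv (Representation.invariantsEquivIntertwiningMap W.ρ V.ρ)
    rw [Nat.cast_eq_zero, Module.finrank_zero_iff] at h0
    exact absurd (Subsingleton.elim f 0) hf

lemma exists_eq_smul_of_commute (V : FDRep ℂ G) [Simple V] (f : V →ₗ[ℂ] V)
    (hf : ∀ g, f ∘ₗ V.ρ g = V.ρ g ∘ₗ f) : ∃ c : ℂ, f = c • LinearMap.id := by
  have := Fintype.ofFinite G
  have := invertibleOfNonzero (NeZero.ne (Nat.card G : ℂ))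
  have := V.nontrivial_of_simple
  have h := Representation.card_inv_mul_sum_char_mul_char_eq_finrank V.ρ V.ρ
  have hV := (simple_iff_char_is_norm_one V).1 inferInstance
  have h1 : Module.finrank ℂ (Representation.IntertwiningMap V.ρ V.ρ) = 1 := by
    have h2 := h.symm.trans (congrArg ((Nat.card G : ℂ)⁻¹ * ·) hV)
    simp only [inv_mul_cancel₀ (NeZero.ne (Nat.card G : ℂ))] at h2
    exact_mod_cast h2
  have hid : Representation.IntertwiningMap.id V.ρ ≠ 0 := fun h => by
    obtain ⟨v, hv⟩ := exists_ne (0 : V)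
    exact hv (congrArg (fun f => f v) h)
  obtain ⟨c, hc⟩ := (finrank_eq_one_iff_of_nonzero' _ hid).1 h1 ⟨f, hf⟩
  exact ⟨c, (congrArg Representation.IntertwiningMap.toLinearMap hc).symm⟩

/-- A simple representation with commuting image has a multiplicative character. -/
lemma exists_monoidHom_of_commute (V : FDRep ℂ G) [Simple V]
    (h : ∀ a b, V.ρ a ∘ₗ V.ρ b = V.ρ b ∘ₗ V.ρ a) : ∃ ψ : G →* ℂ, V.character = ψ := by
  have := Fintype.ofFinite G
  have := V.nontrivial_of_simple
  choose c hc using fun g => V.exists_eq_smul_of_commute (V.ρ g) (h g)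
  have hχ : ∀ g, V.character g = c g * Module.finrank ℂ V := fun g => by
    rw [character, hc, map_smul, LinearMap.trace_id, smul_eq_mul]
  have hinj : ∀ a b : ℂ, a • (LinearMap.id : V →ₗ[ℂ] V) = b • LinearMap.id → a = b :=
    fun a b hab => by
      obtain ⟨v, hv⟩ := exists_ne (0 : V)
      exact smul_left_injective ℂ hv (congrArg (fun f => f v) hab)
  have hone : c 1 = 1 := hinj _ _ (by rw [← hc, map_one, one_smul]; rfl)
  have hmul : ∀ a b, c (a * b) = c a * c b := fun a b => hinj _ _ (by
    rw [← hc, map_mul, hc a, hc b, mul_smul]; rfl)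
  have hV := (simple_iff_char_is_norm_one V).1 inferInstance
  have hsq : ∀ g, V.character g * V.character g⁻¹ = (Module.finrank ℂ V : ℂ) ^ 2 := fun g => by
    rw [hχ, hχ, mul_mul_mul_comm, ← hmul, mul_inv_cancel, hone, one_mul, sq]
  simp only [hsq, Finset.sum_const, Finset.card_univ, nsmul_eq_mul, ← Nat.card_eq_fintype_card]
    at hV
  have hd : Module.finrank ℂ V = 1 := by
    have : (Module.finrank ℂ V : ℂ) ^ 2 = 1 := by
      simpa using mul_left_cancel₀ (NeZero.ne (Nat.card G : ℂ)) (hV.trans (mul_one _).symm)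
    have : Module.finrank ℂ V ^ 2 = 1 := by exact_mod_cast this
    simpa using this
  refine ⟨⟨⟨c, hone⟩, hmul⟩, funext fun g => ?_⟩
  simp [hχ, hd]

/-- If the character of `V` is constant on `N`, then `N` acts trivially on `V`. -/
lemma ρ_eq_one_of_character_eq (V : FDRep ℂ G) (N : Subgroup G)
    (h : ∀ n : N, V.character n = V.character 1) (n : N) : V.ρ n = 1 := by
  have := Fintype.ofFinite N
  have := invertibleOfNonzero (NeZero.ne (Nat.card N : ℂ))
  let σ : Representation ℂ N V := V.ρ.comp N.subtype
  have hσ := σ.card_inv_mul_sum_char_eq_finrank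
  have hσ' : ∀ n, σ.character n = Module.finrank ℂ V := fun n => (h n).trans V.char_one
  simp only [hσ', Finset.sum_const, Finset.card_univ, nsmul_eq_mul,
    ← Nat.card_eq_fintype_card] at hσ
  rw [inv_mul_cancel_left₀ (NeZero.ne _), Nat.cast_inj] at hσ
  have htop := Submodule.eq_top_of_finrank_eq hσ.symm
  ext v
  have hv : v ∈ σ.invariants := htop ▸ trivial
  exact hv n

/-- Simple representations of a product are external tensor products of simple representations. -/
lemma exists_character_eq_mul_of_prod {H : Type} [Group H] [Finite H]
    (V : FDRep ℂ (G × H)) [Simple V] :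
    ∃ (W₁ : FDRep ℂ G) (W₂ : FDRep ℂ H), Simple W₁ ∧ Simple W₂ ∧
      ∀ g h, V.character (g, h) = W₁.character g * W₂.character h := by
  have := Fintype.ofFinite G
  have := Fintype.ofFinite H
  have := V.nontrivial_of_simple
  obtain ⟨W₂, hW₂, f₂, hf₂⟩ :=
    exists_simple_intertwiningMap_ne_zero (V.ρ.comp (MonoidHom.inr G H))
  let X : Submodule ℂ (W₂ →ₗ[ℂ] V) :=
    { carrier := {f | ∀ h w, f (W₂.ρ h w) = V.ρ (1, h) (f w)}
      add_mem' := fun {a b} ha hb h w => by simp [ha h w, hb h w]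
      zero_mem' := fun h w => by simp
      smul_mem' := fun c f hf h w => by simp [hf h w] }
  have : Nontrivial X := ⟨⟨⟨f₂.toLinearMap, fun h w => f₂.isIntertwining _ _ h w⟩, 0, fun h =>
    hf₂ (Representation.IntertwiningMap.ext (congrArg Subtype.val h))⟩⟩
  let τ : Representation ℂ G X :=
    { toFun := fun g =>
        { toFun := fun f => ⟨V.ρ (g, 1) ∘ₗ f.1, fun h w => by
            have h1 : V.ρ (g, 1) * V.ρ (1, h) = V.ρ (1, h) * V.ρ (g, 1) := by
              rw [← map_mul, ← map_mul]; simp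
            rw [LinearMap.comp_apply, f.2 h w]
            exact LinearMap.congr_fun h1 _⟩
          map_add' := fun a b => Subtype.ext (LinearMap.comp_add _ _ _)
          map_smul' := fun c a => Subtype.ext (LinearMap.comp_smul _ _ _) }
      map_one' := by
        ext f w
        change V.ρ 1 (f.1 w) = f.1 w
        rw [map_one]; rfl
      map_mul' := fun a b => by
        ext f w
        change V.ρ (a * b, 1) (f.1 w) = V.ρ (a, 1) (V.ρ (b, 1) (f.1 w))
        rw [← Module.End.mul_apply, ← map_mul]; simp }
  obtain ⟨W₁, hW₁, f₁, hf₁⟩ := exists_simple_intertwiningMap_ne_zero τ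
  let T : FDRep ℂ (G × H) := of (Representation.tprod
    (W₁.ρ.comp (MonoidHom.fst G H)) (W₂.ρ.comp (MonoidHom.snd G H)))
  have hT : ∀ x, T.character x = W₁.character x.1 * W₂.character x.2 := fun x =>
    LinearMap.trace_tensorProduct' (W₁.ρ x.1) (W₂.ρ x.2)
  have : Simple T := by
    rw [simple_iff_char_is_norm_one, Nat.card_prod, Nat.cast_mul,
      ← (simple_iff_char_is_norm_one W₁).1 hW₁, ← (simple_iff_char_is_norm_one W₂).1 hW₂,
      Finset.sum_mul_sum, Fintype.sum_prod_type]
    refine Finset.sum_congr rfl fun a _ => Finset.sum_congr rfl fun b _ => ?_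
    rw [hT, hT, Prod.fst_inv, Prod.snd_inv, mul_mul_mul_comm]
  let F : Representation.IntertwiningMap T.ρ V.ρ :=
    ⟨TensorProduct.lift (X.subtype ∘ₗ f₁.toLinearMap), fun x => by
      refine TensorProduct.ext' fun w₁ w₂ => ?_
      change (f₁ (W₁.ρ x.1 w₁)).1 (W₂.ρ x.2 w₂) = V.ρ x ((f₁ w₁).1 w₂)
      rw [f₁.isIntertwining _ _ x.1 w₁, (τ x.1 (f₁ w₁)).2 x.2 w₂]
      change V.ρ (1, x.2) (V.ρ (x.1, 1) _) = _
      rw [← Module.End.mul_apply, ← map_mul]; simp⟩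
  have hF : F ≠ 0 := fun h0 => by
    refine hf₁ (Representation.IntertwiningMap.ext (LinearMap.ext fun w₁ =>
      Subtype.ext (LinearMap.ext fun w₂ => ?_)))
    exact congrArg (fun f => f (w₁ ⊗ₜ[ℂ] w₂)) h0
  exact ⟨W₁, W₂, hW₁, hW₂, fun g h => by
    rw [character_eq_of_intertwiningMap_ne_zero F hF, hT]⟩

end FDRep

lemma isIrrChar_monoidHom {G : Type} [Group G] [Finite G] (ψ : G →* ℂ) : IsIrrChar G ψ := by
  have := Fintype.ofFinite G
  let V : FDRep ℂ G := FDRep.of ((algebraMap ℂ (Module.End ℂ ℂ)).toMonoidHom.comp ψ)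
  have hV : ∀ g, V.character g = ψ g := fun g => by
    change LinearMap.trace ℂ ℂ (algebraMap ℂ (Module.End ℂ ℂ) (ψ g)) = ψ g
    simp [Algebra.algebraMap_eq_smul_one]
  refine ⟨V, ?_, funext hV⟩
  rw [FDRep.simple_iff_char_is_norm_one]
  simp only [hV, ← map_mul, mul_inv_cancel, map_one]
  simp

lemma IsIrrChar.exists_monoidHom {G : Type} [Group G] [Finite G]
    (hG : ∀ a b : G, a * b = b * a) {μ : G → ℂ} (hμ : IsIrrChar G μ) :
    ∃ ψ : G →* ℂ, μ = ψ := by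
  obtain ⟨V, hV, rfl⟩ := hμ
  exact V.exists_monoidHom_of_commute fun a b => by
    have : V.ρ a * V.ρ b = V.ρ b * V.ρ a := by rw [← map_mul, hG, map_mul]
    exact this

lemma multFree_one {G : Type} [Group G] [Finite G] (hG : ∀ a b : G, a * b = b * a) :
    MultFree G (fun _ => 1) := by
  classical
  intro μ hμ
  have := Fintype.ofFinite G
  obtain ⟨ψ, rfl⟩ := hμ.exists_monoidHom hG
  have h := sum_hom_units ((starRingEnd ℂ : ℂ →* ℂ).comp ψ)
  simp only [MonoidHom.comp_apply, MonoidHom.coe_coe] at h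
  simp only [charInner, one_mul, finsum_eq_sum_of_fintype, h]
  split_ifs
  · right
    simp
  · left
    simp

open scoped commutatorElement in
lemma UnramifiedOver.multFree_restrict {G : Type} [Group G] [Finite G] {N : Subgroup G}
    (hab : ∀ a b : N, a * b = b * a) (hc : commutator G ≤ N) (h : UnramifiedOver G N)
    {χ : G → ℂ} (hχ : IsIrrChar G χ) : MultFree N (fun n : N => χ n) := by
  refine (h χ hχ).elim id fun htriv => ?_
  obtain ⟨V, hV, rfl⟩ := hχ
  obtain ⟨ψ, hψ⟩ := V.exists_monoidHom_of_commute fun a b => by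
    have h1 := V.ρ_eq_one_of_character_eq N htriv
      ⟨⁅a, b⁆, hc (Subgroup.commutator_mem_commutator trivial trivial)⟩
    have h2 : V.ρ a * V.ρ b = V.ρ b * V.ρ a := by
      rw [← map_mul, ← map_mul, ← one_mul (V.ρ (b * a)), ← h1, ← map_mul]
      simp [commutatorElement_def, mul_assoc]
    exact h2
  have : (fun n : N => V.character n) = fun _ => 1 :=
    funext fun n => by rw [htriv, hψ, map_one]
  exact this ▸ multFree_one hab

lemma MultFree.prod {G₁ G₂ : Type} [Group G₁] [Group G₂] [Finite G₁] [Finite G₂]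
    {N₁ : Subgroup G₁} {N₂ : Subgroup G₂}
    (hab₁ : ∀ a b : N₁, a * b = b * a) (hab₂ : ∀ a b : N₂, a * b = b * a)
    {φ₁ : N₁ → ℂ} {φ₂ : N₂ → ℂ} (h₁ : MultFree N₁ φ₁) (h₂ : MultFree N₂ φ₂) :
    MultFree (N₁.prod N₂) (fun n => φ₁ ⟨n.1.1, n.2.1⟩ * φ₂ ⟨n.1.2, n.2.2⟩) := by
  have := Fintype.ofFinite N₁
  have := Fintype.ofFinite N₂
  have := Fintype.ofFinite (N₁.prod N₂)
  intro μ hμ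
  let e := Subgroup.prodEquiv N₁ N₂
  obtain ⟨ψ, rfl⟩ := hμ.exists_monoidHom fun a b => e.injective (by
    rw [map_mul, map_mul]; exact Prod.ext (hab₁ _ _) (hab₂ _ _))
  let ψ₁ : N₁ →* ℂ := (ψ.comp e.symm.toMonoidHom).comp (MonoidHom.inl N₁ N₂)
  let ψ₂ : N₂ →* ℂ := (ψ.comp e.symm.toMonoidHom).comp (MonoidHom.inr N₁ N₂)
  have hψ : ∀ a b, ψ (e.symm (a, b)) = ψ₁ a * ψ₂ b := fun a b => by
    change _ = ψ (e.symm (a, 1)) * ψ (e.symm (1, b))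
    rw [← map_mul, ← map_mul, Prod.mk_mul_mk, mul_one, one_mul]
  have hmul : charInner (N₁.prod N₂) (fun n => φ₁ ⟨n.1.1, n.2.1⟩ * φ₂ ⟨n.1.2, n.2.2⟩) ψ =
      charInner N₁ φ₁ ψ₁ * charInner N₂ φ₂ ψ₂ := by
    simp only [charInner, finsum_eq_sum_of_fintype]
    rw [mul_mul_mul_comm, Finset.sum_mul_sum, ← Fintype.sum_prod_type', ← mul_inv,
      ← Nat.cast_mul, ← Nat.card_prod, Nat.card_congr e.toEquiv, ← e.symm.toEquiv.sum_comp]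
    congr 1
    refine Finset.sum_congr rfl fun x _ => ?_
    change φ₁ x.1 * φ₂ x.2 * (starRingEnd ℂ) (ψ (e.symm (x.1, x.2))) = _
    rw [hψ, map_mul, mul_mul_mul_comm]
  rw [hmul]
  rcases h₁ ψ₁ (isIrrChar_monoidHom ψ₁) with h | h <;>
    rcases h₂ ψ₂ (isIrrChar_monoidHom ψ₂) with h' | h' <;> simp [h, h']

/-- If Gᵢ is unramified over an abelian normal subgroup Nᵢ containing the
commutator subgroup Gᵢ', then G₁ × G₂ is unramified over N₁ × N₂. -/
theorem stmt_12 {G₁ G₂ : Type} [Group G₁] [Group G₂] [Finite G₁] [Finite G₂]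
    (N₁ : Subgroup G₁) (N₂ : Subgroup G₂) [N₁.Normal] [N₂.Normal]
    (hab₁ : ∀ a b : ↥N₁, a * b = b * a) (hab₂ : ∀ a b : ↥N₂, a * b = b * a)
    (hc₁ : commutator G₁ ≤ N₁) (hc₂ : commutator G₂ ≤ N₂)
    (h₁ : UnramifiedOver G₁ N₁) (h₂ : UnramifiedOver G₂ N₂) :
    UnramifiedOver (G₁ × G₂) (N₁.prod N₂) := by 
  rintro _ ⟨V, hV, rfl⟩
  obtain ⟨W₁, W₂, hW₁, hW₂, h⟩ := V.exists_character_eq_mul_of_prod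
  have key := (h₁.multFree_restrict hab₁ hc₁ ⟨W₁, hW₁, rfl⟩).prod hab₁ hab₂
    (h₂.multFree_restrict hab₂ hc₂ ⟨W₂, hW₂, rfl⟩)
  left
  convert! key using 2
  exact h _ _
end
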